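/- Let b, c ≥ 0 be real numbers with b + c ≤ 3, and let v ∈ ℂ³ ⊗ ℂ³ be a unit vector. Then every eigenvalue of the Hermitian matrix (id_3 ⊗ Φ_{b,c}†)(v v†) is at least −(b+c)/6, where Φ_{b,c}† = Φ_{c,b} is the dual of the generalized Choi map Φ_{b,c}. -/

import Mathlib

open Matrix BigOperators
open scoped ComplexOrder

noncomputable section

/-- The generalized Choi map `Φ_{b,c} : M₃(ℂ) → M₃(ℂ)` (with `a = 2 - b - c`). -/
def PhiG (b c : ℝ) (X : Matrix (Fin 3) (Fin 3) ℂ) : Matrix (Fin 3) (Fin 3) ℂ :=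
  (1 / 2 : ℂ) •
    !![((2 - b - c : ℝ) : ℂ) * X 0 0 + (b : ℂ) * X 1 1 + (c : ℂ) * X 2 2,
         -(X 0 1), -(X 0 2);
       -(X 1 0),
         (c : ℂ) * X 0 0 + ((2 - b - c : ℝ) : ℂ) * X 1 1 + (b : ℂ) * X 2 2,
         -(X 1 2);
       -(X 2 0), -(X 2 1),
         (b : ℂ) * X 0 0 + (c : ℂ) * X 1 1 + ((2 - b - c : ℝ) : ℂ) * X 2 2]

/-- The map `id_n ⊗ Φ`, acting blockwise on an `n² × n²` matrix indexed by
`Fin n × Fin n`. -/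
def idTensor {n : ℕ} (Φ : Matrix (Fin n) (Fin n) ℂ → Matrix (Fin n) (Fin n) ℂ)
    (X : Matrix (Fin n × Fin n) (Fin n × Fin n) ℂ) :
    Matrix (Fin n × Fin n) (Fin n × Fin n) ℂ :=
  Matrix.of fun p q => Φ (Matrix.of fun k l => X (p.1, k) (q.1, l)) p.2 q.2

/-- The quadratic form of `(id₃ ⊗ Φ_{c,b})(v v†)` at `w`, expressed through the inner products of
the columns of `w` and `v`. -/
lemma star_dotProduct_idTensor_PhiG_mulVec (b c : ℝ) (v w : Fin 3 × Fin 3 → ℂ)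
    (z : Fin 3 → Fin 3 → ℂ) (hz : ∀ k m, z k m = ∑ i, star (w (i, k)) * v (i, m)) :
    star w ⬝ᵥ (idTensor (PhiG c b) (Matrix.vecMulVec v (star v)) *ᵥ w) =
      (((1 / 2) * ((3 - b - c) * ∑ k, ‖z k k‖ ^ 2 + c * ∑ k, ‖z k (k + 1)‖ ^ 2 +
        b * ∑ k, ‖z k (k + 2)‖ ^ 2 - ‖∑ k, z k k‖ ^ 2) : ℝ) : ℂ) := by
  push_cast
  simp only [← Complex.mul_conj', hz]
  simp [dotProduct, mulVec, Fintype.sum_prod_type, Fin.sum_univ_three, idTensor, PhiG,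
    vecMulVec_apply]
  ring

lemma norm_sum_sq_le_three_mul (z : Fin 3 → ℂ) : ‖∑ k, z k‖ ^ 2 ≤ 3 * ∑ k, ‖z k‖ ^ 2 :=
  calc ‖∑ k, z k‖ ^ 2 ≤ (∑ k, ‖z k‖) ^ 2 := by gcongr; exact norm_sum_le _ _
    _ ≤ 3 * ∑ k, ‖z k‖ ^ 2 := by
      simpa using sq_sum_le_card_mul_sum_sq (s := Finset.univ) (f := fun k => ‖z k‖)

/-- For `b, c ≥ 0` with `b + c ≤ 3` and a unit vector `v ∈ ℂ³ ⊗ ℂ³`, the eigenvalues of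
`(id₃ ⊗ Φ_{b,c}†)(v v†)` (where `Φ_{b,c}† = Φ_{c,b}`) are at least `-(b+c)/6`. -/
theorem eigenvalues_idTensor_PhiGdual_lower_bound (b c : ℝ) (hb : 0 ≤ b) (hc : 0 ≤ c)
    (hbc : b + c ≤ 3) (v : Fin 3 × Fin 3 → ℂ)
    (hv : (∑ p, star (v p) * v p) = (1 : ℂ))
    (h : (idTensor (PhiG c b) (Matrix.vecMulVec v (star v))).IsHermitian) :
    ∀ i, -((b + c) / 6) ≤ h.eigenvalues i := by
  intro i
  set u := h.eigenvectorBasis i with hu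
  set z : Fin 3 → Fin 3 → ℂ := fun k m => ∑ i, star (u (i, k)) * v (i, m) with hz
  have heig : h.eigenvalues i = _ := h.eigenvalues_eq i
  rw [← hu, star_dotProduct_idTensor_PhiG_mulVec b c v u z fun _ _ => rfl] at heig
  have hnorm_v : ‖WithLp.toLp 2 v‖ = 1 := by
    have hsq : ((‖WithLp.toLp 2 v‖ ^ 2 : ℝ) : ℂ) = 1 := by
      rw [← hv, EuclideanSpace.norm_sq_eq]
      push_cast
      simp [← Complex.conj_mul']
    have hsq' : ‖WithLp.toLp 2 v‖ ^ 2 = 1 := by exact_mod_cast hsq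
    exact (pow_eq_one_iff_of_nonneg (norm_nonneg _) two_ne_zero).mp hsq'
  have hinner : inner ℂ u (WithLp.toLp 2 v) = ∑ k, z k k := by
    simp [PiLp.inner_apply, Fintype.sum_prod_type_right, hz, mul_comm]
  have hone : ‖∑ k, z k k‖ ^ 2 ≤ 1 := by
    have hcs := norm_inner_le_norm (𝕜 := ℂ) u (WithLp.toLp 2 v)
    rw [hinner, hnorm_v, h.eigenvectorBasis.orthonormal.1 i] at hcs
    exact pow_le_one₀ (norm_nonneg _) (by simpa using hcs)
  have hthree := norm_sum_sq_le_three_mul fun k => z k k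
  have hnext : 0 ≤ c * ∑ k, ‖z k (k + 1)‖ ^ 2 := by positivity
  have hprev : 0 ≤ b * ∑ k, ‖z k (k + 2)‖ ^ 2 := by positivity
  rw [heig, RCLike.re_eq_complex_re, Complex.ofReal_re]
  nlinarith [mul_le_mul_of_nonneg_left hthree (sub_nonneg.mpr hbc),
    mul_le_mul_of_nonneg_left hone (add_nonneg hb hc)]

end
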